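/- Let G be a DAG over a target vertex Y and covariates X such that Y is adjacent to a covariate X₀ ∈ X, and every vertex of X ∖ {X₀} is adjacent to at most one of Y and X₀. Let G̃ be the graph over a target vertex Ỹ and covariates X ∖ {X₀} obtained by contracting Y and X₀ into Ỹ: for V ∈ X ∖ {X₀}, G̃ has the edge Ỹ → V if and only if G has Y → V or X₀ → V, and the edge V → Ỹ if and only if G has V → Y or V → X₀; all edges among X ∖ {X₀} are as in G. Assume G̃ is acyclic. Then N_{G̃} + 1 ≤ N_G ≤ 2·N_{G̃}. -/

import Mathlib

/-- A finite directed acyclic graph on a vertex type `V`: an edge relation with no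
directed cycles. -/
structure DAG (V : Type*) where
  edge : V → V → Prop
  acyclic : ∀ v, ¬ Relation.TransGen edge v v

/-- A path: a sequence of at least two distinct vertices in which consecutive vertices
are joined by an edge (in either direction). -/
def IsPath {V : Type*} (E : V → V → Prop) (p : List V) : Prop :=
  2 ≤ p.length ∧ p.Nodup ∧
    ∀ i, ∀ h : i + 1 < p.length,
      E (p.get ⟨i, Nat.lt_of_succ_lt h⟩) (p.get ⟨i + 1, h⟩) ∨
      E (p.get ⟨i + 1, h⟩) (p.get ⟨i, Nat.lt_of_succ_lt h⟩)

/-- The vertex at position `i` of the path `p` is a collider on `p`: it is an interior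
vertex and both adjacent edges of the path point into it. -/
def IsColliderAt {V : Type*} (E : V → V → Prop) (p : List V) (i : ℕ) : Prop :=
  ∃ (h1 : 1 ≤ i) (h2 : i + 1 < p.length),
    E (p.get ⟨i - 1, by omega⟩) (p.get ⟨i, by omega⟩) ∧
    E (p.get ⟨i + 1, h2⟩) (p.get ⟨i, by omega⟩)

/-- A path is blocked by a vertex set `Z` if it contains a non-collider belonging to
`Z`, or a collider such that neither the collider itself nor any of its descendants
belongs to `Z`. -/
def Blocked {V : Type*} (E : V → V → Prop) (Z : Set V) (p : List V) : Prop :=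
  (∃ i, ∃ h : i < p.length, ¬ IsColliderAt E p i ∧ p.get ⟨i, h⟩ ∈ Z) ∨
  (∃ i, ∃ h : i < p.length, IsColliderAt E p i ∧ p.get ⟨i, h⟩ ∉ Z ∧
    ∀ w, Relation.TransGen E (p.get ⟨i, h⟩) w → w ∉ Z)

/-- `p` is a path between the vertices `u` and `v`. -/
def PathBetween {V : Type*} (E : V → V → Prop) (p : List V) (u v : V) : Prop :=
  IsPath E p ∧ p.head? = some u ∧ p.getLast? = some v

/-- `A` is d-separated from `B` given `Z`: every path between a vertex of `A` and a
vertex of `B` is blocked by `Z`. -/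
def DSep {V : Type*} (E : V → V → Prop) (A B Z : Set V) : Prop :=
  ∀ (p : List V) (u v : V), PathBetween E p u v → u ∈ A → v ∈ B → Blocked E Z p

/-- The set of covariate vertices (in `Option ι`, the target is `none` and the covariate
with index `i` is `some i`) indexed by a finite index set `S`. -/
def XSet {ι : Type*} (S : Finset ι) : Set (Option ι) := {v | ∃ i ∈ S, v = some i}

/-- The equivalence relation `∼_G` on subsets of the covariate index set: `S' ∼_G S''`
iff there is `S_∩ ⊆ S' ∩ S''` such that the target `Y` (= `none`) is d-separated from
`X_{(S' ∪ S'') ∖ S_∩}` given `X_{S_∩}` in `G`. -/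
def SimG {ι : Type*} [DecidableEq ι] (G : DAG (Option ι)) (S' S'' : Finset ι) : Prop :=
  ∃ Scap : Finset ι, Scap ⊆ S' ∩ S'' ∧
    DSep G.edge {none} (XSet ((S' ∪ S'') \ Scap)) (XSet Scap)

/-- `N_G`: the number of equivalence classes of `∼_G`. -/
noncomputable def NG {ι : Type*} [DecidableEq ι] (G : DAG (Option ι)) : ℕ :=
  Nat.card (Quot (SimG G))

/-- Adjacency in the skeleton of a DAG. -/
def SkelAdj {V : Type*} (G : DAG V) (a b : V) : Prop := G.edge a b ∨ G.edge b a

/-- The edge relation obtained from a graph over target `Y` (= `none`) and covariates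
`ι` by contracting `Y` and the covariate `x0` into a single new target `Ỹ`: for a
remaining covariate `v`, `Ỹ → v` iff `Y → v` or `x0 → v` in `G`, and `v → Ỹ` iff
`v → Y` or `v → x0` in `G`; edges among remaining covariates are unchanged. -/
def contractEdge {ι : Type*} (E : Option ι → Option ι → Prop) (x0 : ι) :
    Option {i : ι // i ≠ x0} → Option {i : ι // i ≠ x0} → Prop
  | none, none => False
  | none, some v => E none (some v.1) ∨ E (some x0) (some v.1)
  | some v, none => E (some v.1) none ∨ E (some v.1) (some x0)
  | some v, some w => E (some v.1) (some w.1)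

/-- Bayes-ball reachability: states are a vertex and a flag telling whether the last edge
points into the vertex. -/
inductive BReach {V : Type*} (E : V → V → Prop) (Y : V) (Z : Set V) : V → Bool → Prop
  | start : BReach E Y Z Y false
  | fwd {v w : V} {d : Bool} : BReach E Y Z v d → E v w → v ∉ Z → BReach E Y Z w true
  | coll {v w : V} : BReach E Y Z v true → E w v → v ∈ Z → BReach E Y Z w false
  | bwd {v w : V} : BReach E Y Z v false → E w v → v ∉ Z → BReach E Y Z w false

/-- Visited vertices. -/
def BVis {V : Type*} (E : V → V → Prop) (Y : V) (Z : Set V) (v : V) : Prop :=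
  ∃ d, BReach E Y Z v d

section general
variable {V : Type*} {E : V → V → Prop} {Y : V}

lemma BReach.up {Z : Set V} {v z : V} (h : Relation.ReflTransGen E v z) (hz : z ∈ Z) :
    BReach E Y Z v true → ∀ w, E w v → BReach E Y Z w false := by
  induction h using Relation.ReflTransGen.head_induction_on with
  | refl => intro hr w hw; exact hr.coll hw hz
  | @head a c hac _ ih =>
    intro hr w hw
    by_cases ha : a ∈ Z
    · exact hr.coll hw ha
    · exact (ih (hr.fwd hac ha) a hac).bwd hw ha

lemma BReach.mono_agree {Z1 Z2 : Set V} (h : ∀ v, BVis E Y Z1 v → (v ∈ Z1 ↔ v ∈ Z2))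
    {v : V} {d : Bool} (hr : BReach E Y Z1 v d) : BReach E Y Z2 v d := by
  induction hr with
  | start => exact .start
  | fwd h1 e hn ih => exact ih.fwd e (fun h' => hn ((h _ ⟨_, h1⟩).2 h'))
  | coll h1 e hn ih => exact ih.coll e ((h _ ⟨_, h1⟩).1 hn)
  | bwd h1 e hn ih => exact ih.bwd e (fun h' => hn ((h _ ⟨_, h1⟩).2 h'))

lemma BReach.mono_agree' {Z1 Z2 : Set V} (h : ∀ v, BVis E Y Z1 v → (v ∈ Z1 ↔ v ∈ Z2))
    {v : V} {d : Bool} (hr : BReach E Y Z2 v d) : BReach E Y Z1 v d := by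
  induction hr with
  | start => exact .start
  | fwd h1 e hn ih => exact ih.fwd e (fun h' => hn ((h _ ⟨_, ih⟩).1 h'))
  | coll h1 e hn ih => exact ih.coll e ((h _ ⟨_, ih⟩).2 hn)
  | bwd h1 e hn ih => exact ih.bwd e (fun h' => hn ((h _ ⟨_, ih⟩).1 h'))

lemma BVis_congr {Z1 Z2 : Set V} (h : ∀ v, BVis E Y Z1 v → (v ∈ Z1 ↔ v ∈ Z2)) (v : V) :
    BVis E Y Z1 v ↔ BVis E Y Z2 v :=
  ⟨fun ⟨d, hd⟩ => ⟨d, hd.mono_agree h⟩, fun ⟨d, hd⟩ => ⟨d, hd.mono_agree' h⟩⟩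

lemma asymm_of_acyclic (hac : ∀ v, ¬ Relation.TransGen E v v) {a b : V} (h : E a b) : ¬ E b a :=
  fun h' => hac a ((Relation.TransGen.single h).tail h')

lemma vis_of_path (hac : ∀ v, ¬ Relation.TransGen E v v) {Z : Set V} {p : List V} {b : V}
    (hp : PathBetween E p Y b) (hb : ¬ Blocked E Z p) : BVis E Y Z b := by
  obtain ⟨⟨hlen, -, hadj⟩, hhead, hlast⟩ := hp
  have hnc : ∀ i, ∀ h : i < p.length, ¬ IsColliderAt E p i → p.get ⟨i, h⟩ ∉ Z :=
    fun i h h1 h2 => hb (Or.inl ⟨i, h, h1, h2⟩)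
  have hc : ∀ i, ∀ h : i < p.length, IsColliderAt E p i →
      ∃ z ∈ Z, Relation.ReflTransGen E (p.get ⟨i, h⟩) z := by
    intro i h h1
    by_contra hcon
    push Not at hcon
    exact hb (Or.inr ⟨i, h, h1, fun h2 => hcon _ h2 .refl,
      fun w hw h2 => hcon _ h2 hw.to_reflTransGen⟩)
  have key : ∀ i, ∀ h : i < p.length, ∃ d, BReach E Y Z (p.get ⟨i, h⟩) d ∧
      (d = true → ∃ _ : 1 ≤ i, E (p.get ⟨i - 1, by omega⟩) (p.get ⟨i, h⟩)) ∧
      (d = false → ∀ _ : 1 ≤ i, E (p.get ⟨i, h⟩) (p.get ⟨i - 1, by omega⟩)) := by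
    intro i
    induction i with
    | zero =>
      intro h
      refine ⟨false, ?_, by simp, fun _ h => by omega⟩
      have : p.get ⟨0, h⟩ = Y := by
        cases p with
        | nil => simp at h
        | cons a l => simpa using hhead
      rw [this]; exact .start
    | succ i ih =>
      intro h
      obtain ⟨d, hd, hd1, hd2⟩ := ih (by omega)
      rcases hadj i h with he | he
      · refine ⟨true, hd.fwd he (hnc _ _ ?_), fun _ => ⟨by omega, he⟩, by simp⟩
        rintro ⟨_, _, _, h4⟩
        exact asymm_of_acyclic hac he h4
      · refine ⟨false, ?_, by simp, fun _ _ => he⟩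
        cases d with
        | true =>
          obtain ⟨h1, h2⟩ := hd1 rfl
          obtain ⟨z, hz, hz'⟩ := hc i (by omega) ⟨h1, h, h2, he⟩
          exact BReach.up hz' hz hd _ he
        | false =>
          refine hd.bwd he (hnc _ _ ?_)
          rintro ⟨h1, _, h3, _⟩
          exact asymm_of_acyclic hac (hd2 rfl h1) h3
  obtain ⟨d, hd, -⟩ := key (p.length - 1) (by omega)
  have : p.get ⟨p.length - 1, by omega⟩ = b := by
    rw [List.getLast?_eq_getElem?] at hlast
    rw [List.getElem?_eq_getElem (by omega)] at hlast
    simpa using hlast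
  rw [this] at hd
  exact ⟨d, hd⟩

/-- Active path given as a function. -/
structure APath (E : V → V → Prop) (Y : V) (Z : Set V) (f : ℕ → V) (n : ℕ) : Prop where
  zero : f 0 = Y
  inj : ∀ i j, i ≤ n → j ≤ n → f i = f j → i = j
  adj : ∀ i, i < n → E (f i) (f (i+1)) ∨ E (f (i+1)) (f i)
  coll : ∀ i, i + 1 < n → E (f i) (f (i+1)) → E (f (i+2)) (f (i+1)) →
    ∃ z ∈ Z, Relation.ReflTransGen E (f (i+1)) z
  nonc : ∀ i, i + 1 < n → ¬ (E (f i) (f (i+1)) ∧ E (f (i+2)) (f (i+1))) → f (i+1) ∉ Z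

/-- Arrival by an edge pointing into the end. -/
def ArrHead (E : V → V → Prop) (f : ℕ → V) (n : ℕ) : Prop := ∃ m, n = m + 1 ∧ E (f m) (f n)

lemma APath.trunc {Z : Set V} {f : ℕ → V} {n m : ℕ} (h : APath E Y Z f n) (hm : m ≤ n) :
    APath E Y Z f m :=
  ⟨h.zero, fun i j hi hj => h.inj i j (by omega) (by omega), fun i hi => h.adj i (by omega),
    fun i hi => h.coll i (by omega), fun i hi => h.nonc i (by omega)⟩

lemma APath.extend {Z : Set V} {f : ℕ → V} {n : ℕ} {w : V} (h : APath E Y Z f n)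
    (hw : ∀ i ≤ n, f i ≠ w) (hadj : E (f n) w ∨ E w (f n))
    (hcoll : ArrHead E f n → E w (f n) → ∃ z ∈ Z, Relation.ReflTransGen E (f n) z)
    (hnonc : 0 < n → ¬ (ArrHead E f n ∧ E w (f n)) → f n ∉ Z) :
    APath E Y Z (fun i => if i ≤ n then f i else w) (n+1) := by
  refine ⟨by simpa using h.zero, ?_, ?_, ?_, ?_⟩
  · intro i j hi hj
    try dsimp only
    split_ifs with h1 h2 h2
    · exact h.inj i j h1 h2
    · exact fun h' => absurd h' (hw i h1)
    · exact fun h' => absurd h'.symm (hw j h2)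
    · intro; omega
  · intro i hi
    try dsimp only
    rw [if_pos (by omega)]
    split_ifs with h1
    · exact h.adj i (by omega)
    · obtain rfl : i = n := by omega
      exact hadj
  · intro i hi
    try dsimp only
    rw [if_pos (by omega), if_pos (by omega)]
    split_ifs with h1
    · exact h.coll i (by omega)
    · obtain rfl : n = i + 1 := by omega
      exact fun a b => hcoll ⟨i, rfl, a⟩ b
  · intro i hi
    try dsimp only
    rw [if_pos (by omega), if_pos (by omega)]
    split_ifs with h1
    · exact h.nonc i (by omega)
    · obtain rfl : n = i + 1 := by omega
      intro a
      refine hnonc (by omega) ?_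
      rintro ⟨⟨m, hm, hm'⟩, b⟩
      obtain rfl : i = m := by omega
      exact a ⟨hm', b⟩

/-- Following a path forward from an outgoing edge. -/
lemma APath.down {Z : Set V} {f : ℕ → V} {n : ℕ} (h : APath E Y Z f n) (k : ℕ) :
    ∀ m, m + k + 1 = n → E (f m) (f (m+1)) →
      (∃ z ∈ Z, Relation.ReflTransGen E (f m) z) ∨
      (ArrHead E f n ∧ Relation.ReflTransGen E (f m) (f n)) := by
  induction k with
  | zero =>
    intro m hm he
    right
    subst hm
    exact ⟨⟨m, rfl, he⟩, .single he⟩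
  | succ k ih =>
    intro m hm he
    rcases h.adj (m+1) (by omega) with h1 | h1
    · rcases ih (m+1) (by omega) h1 with ⟨z, hz, hz'⟩ | ⟨ha, hr⟩
      · exact Or.inl ⟨z, hz, .head he hz'⟩
      · exact Or.inr ⟨ha, .head he hr⟩
    · obtain ⟨z, hz, hz'⟩ := h.coll m (by omega) he h1
      exact Or.inl ⟨z, hz, .head he hz'⟩

lemma apath_of_reach (hac : ∀ v, ¬ Relation.TransGen E v v) {Z : Set V} (hY : Y ∉ Z)
    {v : V} {d : Bool} (hr : BReach E Y Z v d) :
    ∃ f n, APath E Y Z f n ∧ f n = v ∧ (d = true → ¬ ArrHead E f n → v ∉ Z) ∧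
      (d = false → ArrHead E f n → ∃ z ∈ Z, Relation.ReflTransGen E v z) := by
  -- truncated prefix: tail arrival means not in Z
  have htail : ∀ (f : ℕ → V) (n m : ℕ), APath E Y Z f n → m < n → ¬ ArrHead E f m → f m ∉ Z := by
    intro f n m h hm hA
    cases m with
    | zero => rw [h.zero]; exact hY
    | succ m => exact h.nonc m hm (fun h' => hA ⟨m, rfl, h'.1⟩)
  have hback : ∀ (v w : V) (f : ℕ → V) (n : ℕ), APath E Y Z f n → f n = v → E w v →
      (ArrHead E f n → ∃ z ∈ Z, Relation.ReflTransGen E v z) →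
      (¬ ArrHead E f n → v ∉ Z) →
      ∃ f n, APath E Y Z f n ∧ f n = w ∧ ((false : Bool) = true → ¬ ArrHead E f n → w ∉ Z) ∧
      ((false : Bool) = false → ArrHead E f n → ∃ z ∈ Z, Relation.ReflTransGen E w z) := by
    intro v w f n hp hv e h1 h2
    subst hv
    by_cases hw : ∀ i ≤ n, f i ≠ w
    · refine ⟨_, _, hp.extend hw (Or.inr e) (fun a _ => h1 a)
        (fun _ a => h2 (fun b => a ⟨b, e⟩)), by simp, by simp, ?_⟩
      rintro - ⟨m, hm, hm'⟩
      obtain rfl : n = m := by omega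
      simp only [le_refl, if_true] at hm'
      rw [if_neg (by omega)] at hm'
      exact absurd hm' (asymm_of_acyclic hac e)
    · push Not at hw
      obtain ⟨m, hm, rfl⟩ := hw
      have hmn : m < n := by
        rcases hm.lt_or_eq with h | rfl
        · exact h
        · exact absurd (.single e) (hac _)
      refine ⟨f, m, hp.trunc hm, rfl, by simp, ?_⟩
      rintro - hA
      rcases hp.adj m hmn with h3 | h3
      · rcases hp.down (n - m - 1) m (by omega) h3 with h4 | ⟨h4, h5⟩
        · exact h4
        · obtain ⟨z, hz, hz'⟩ := h1 h4
          exact ⟨z, hz, h5.trans hz'⟩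
      · obtain ⟨k, rfl, hk⟩ := hA
        exact hp.coll k hmn hk h3
  induction hr with
  | start =>
    refine ⟨fun _ => Y, 0, ⟨rfl, ?_, ?_, ?_, ?_⟩, rfl, by simp, ?_⟩
    · intro i j hi hj _; omega
    · intro i hi; omega
    · intro i hi; omega
    · intro i hi; omega
    · rintro - ⟨m, hm, -⟩; omega
  | @fwd v w d h1 e hn ih =>
    obtain ⟨f, n, hp, rfl, h2, h3⟩ := ih
    by_cases hw : ∀ i ≤ n, f i ≠ w
    · refine ⟨_, _, hp.extend hw (Or.inl e) (fun _ a => absurd a (asymm_of_acyclic hac e))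
        (fun _ _ => hn), by simp, ?_, by simp⟩
      intro _ hA
      exact absurd ⟨n, rfl, by simpa using e⟩ hA
    · push Not at hw
      obtain ⟨m, hm, rfl⟩ := hw
      have hmn : m < n := by
        rcases hm.lt_or_eq with h | rfl
        · exact h
        · exact absurd (.single e) (hac _)
      exact ⟨f, m, hp.trunc hm, rfl, fun _ hA => htail f n m hp hmn hA, by simp⟩
  | @coll v w h1 e hn ih =>
    obtain ⟨f, n, hp, hv, h2, h3⟩ := ih
    exact hback v w f n hp hv e (fun _ => ⟨v, hn, .refl⟩) (h2 rfl)
  | @bwd v w h1 e hn ih =>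
    obtain ⟨f, n, hp, hv, h2, h3⟩ := ih
    exact hback v w f n hp hv e (h3 rfl) (fun _ => hn)

lemma path_of_vis (hac : ∀ v, ¬ Relation.TransGen E v v) {Z : Set V} (hY : Y ∉ Z)
    {b : V} (hb : b ∉ Z) (hbY : b ≠ Y) (hr : BVis E Y Z b) :
    ∃ p, PathBetween E p Y b ∧ ¬ Blocked E Z p := by
  obtain ⟨d, hd⟩ := hr
  obtain ⟨f, n, hp, hfn, -, -⟩ := apath_of_reach hac hY hd
  have hn : 0 < n := by
    rcases Nat.eq_zero_or_pos n with rfl | h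
    · exact absurd (hfn.symm.trans hp.zero) hbY
    · exact h
  refine ⟨(List.range (n+1)).map f, ⟨⟨by simp; omega, ?_, ?_⟩, ?_, ?_⟩, ?_⟩
  · refine List.Nodup.map_on ?_ List.nodup_range
    intro x hx y hy hxy
    rw [List.mem_range] at hx hy
    exact hp.inj x y (by omega) (by omega) hxy
  · intro i h
    simp only [List.length_map, List.length_range] at h
    simpa using hp.adj i (by omega)
  · simp [List.head?_range, hp.zero]
  · simp [List.getLast?_range, hfn]
  · rintro (⟨i, h, h1, h2⟩ | ⟨i, h, h1, h2, h3⟩)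
    · simp only [List.length_map, List.length_range] at h
      simp only [List.get_eq_getElem, List.getElem_map, List.getElem_range] at h2
      rcases Nat.eq_zero_or_pos i with rfl | hi
      · exact hY (hp.zero ▸ h2)
      · rcases Nat.lt_or_ge i n with hin | hin
        · obtain ⟨j, rfl⟩ : ∃ j, i = j + 1 := ⟨i - 1, by omega⟩
          refine hp.nonc j hin ?_ h2
          rintro ⟨a, b⟩
          exact h1 ⟨by omega, by simpa using hin, by simpa using a, by simpa using b⟩
        · obtain rfl : i = n := by omega
          exact hb (hfn ▸ h2)
    · obtain ⟨a, b, c, e⟩ := h1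
      obtain ⟨j, rfl⟩ : ∃ j, i = j + 1 := ⟨i - 1, by omega⟩
      simp only [List.length_map, List.length_range] at b
      simp only [List.get_eq_getElem, List.getElem_map, List.getElem_range] at c e h2 h3
      obtain ⟨z, hz, hz'⟩ := hp.coll j (by omega) (by simpa using c) e
      rcases Relation.reflTransGen_iff_eq_or_transGen.1 hz' with rfl | h4
      · exact h2 hz
      · exact h3 z h4 hz

end general

section classes
variable {ι : Type*} [DecidableEq ι] (G : DAG (Option ι))

lemma some_mem_XSet {S : Finset ι} {i : ι} : some i ∈ XSet S ↔ i ∈ S := by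
  simp [XSet]

lemma none_not_mem_XSet {S : Finset ι} : (none : Option ι) ∉ XSet S := by
  simp [XSet]

/-- Visited covariates. -/
def GVis (S : Finset ι) (v : Option ι) : Prop := BVis G.edge none (XSet S) v

lemma dsep_iff (S Z : Finset ι) (hd : ∀ i ∈ S, i ∉ Z) :
    DSep G.edge {none} (XSet S) (XSet Z) ↔ ∀ i ∈ S, ¬ GVis G Z (some i) := by
  constructor
  · intro h i hi hv
    obtain ⟨p, hp, hb⟩ := path_of_vis G.acyclic none_not_mem_XSet
      (fun h' => hd i hi (some_mem_XSet.1 h')) (by simp) hv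
    exact hb (h p _ _ hp rfl (some_mem_XSet.2 hi))
  · rintro h p u v hp rfl ⟨i, hi, rfl⟩
    by_contra hb
    exact h i hi (vis_of_path G.acyclic hp hb)

lemma GVis_congr {S T : Finset ι} (h : ∀ i, GVis G S (some i) → (i ∈ S ↔ i ∈ T))
    (v : Option ι) : GVis G S v ↔ GVis G T v := by
  refine BVis_congr ?_ v
  rintro (_ | i) hv
  · simp [none_not_mem_XSet]
  · simpa [some_mem_XSet] using h i hv

open Classical in
/-- Markov boundary. -/
noncomputable def MBd (S : Finset ι) : Finset ι := S.filter (fun i => GVis G S (some i))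

lemma mem_MBd {S : Finset ι} {i : ι} : i ∈ MBd G S ↔ i ∈ S ∧ GVis G S (some i) := by
  simp [MBd]

lemma GVis_MBd (S : Finset ι) (v : Option ι) : GVis G S v ↔ GVis G (MBd G S) v :=
  GVis_congr G (fun i hi => by simp [mem_MBd, hi]) v

lemma MBd_idem (S : Finset ι) : MBd G (MBd G S) = MBd G S := by
  ext i
  rw [mem_MBd, ← GVis_MBd, mem_MBd]
  tauto

lemma sim_MBd (S : Finset ι) : SimG G S (MBd G S) := by
  refine ⟨MBd G S, fun i hi => ?_, ?_⟩
  · exact Finset.mem_inter.2 ⟨((mem_MBd G).1 hi).1, hi⟩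
  · rw [dsep_iff _ _ _ (fun i hi => (Finset.mem_sdiff.1 hi).2)]
    intro i hi
    rw [← GVis_MBd]
    simp only [Finset.mem_sdiff, Finset.mem_union, mem_MBd] at hi
    tauto

lemma MBd_of_sep {S Z : Finset ι} (hZ : Z ⊆ S) (h : ∀ i ∈ S, i ∉ Z → ¬ GVis G Z (some i)) :
    MBd G S = MBd G Z := by
  have hv := GVis_congr G (S := Z) (T := S)
    (fun i hi => ⟨fun h' => hZ h', fun h' => by by_contra h2; exact h i h' h2 hi⟩)
  ext i
  rw [mem_MBd, mem_MBd, ← hv]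
  constructor
  · rintro ⟨h1, h2⟩
    refine ⟨?_, h2⟩
    by_contra h3
    exact h i h1 h3 h2
  · rintro ⟨h1, h2⟩
    exact ⟨hZ h1, h2⟩

lemma MBd_of_sim {S T : Finset ι} (h : SimG G S T) : MBd G S = MBd G T := by
  obtain ⟨Z, hZ, h⟩ := h
  rw [dsep_iff _ _ _ (fun i hi => (Finset.mem_sdiff.1 hi).2)] at h
  rw [MBd_of_sep G (S := S) (Z := Z), MBd_of_sep G (S := T) (Z := Z)]
  · exact hZ.trans Finset.inter_subset_right
  · intro i hi hi'
    exact h i (by simp [hi, hi'])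
  · exact hZ.trans Finset.inter_subset_left
  · intro i hi hi'
    exact h i (by simp [hi, hi'])

/-- Stable sets. -/
def Stab (B : Finset ι) : Prop := ∀ i ∈ B, GVis G B (some i)

lemma stab_iff {B : Finset ι} : Stab G B ↔ MBd G B = B := by
  constructor
  · intro h; ext i; rw [mem_MBd]; exact ⟨fun h => h.1, fun h' => ⟨h', h i h'⟩⟩
  · intro h i hi; rw [← h, mem_MBd] at hi; exact hi.2

lemma NG_eq : NG G = Nat.card {B : Finset ι // Stab G B} := by
  refine Nat.card_congr ⟨Quot.lift (fun S => ⟨MBd G S, (stab_iff G).2 (MBd_idem G S)⟩) ?_,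
    fun B => Quot.mk _ B.1, ?_, ?_⟩
  · intro S T h
    exact Subtype.ext (MBd_of_sim G h)
  · intro q
    induction q using Quot.ind with
    | mk S => exact (Quot.sound (sim_MBd G S)).symm
  · intro B
    exact Subtype.ext ((stab_iff G).1 B.2)

end classes

section merge
variable {ι : Type*} [DecidableEq ι]

/-- Remaining covariates of a set. -/
def restr (x0 : ι) (S : Finset ι) : Finset {i : ι // i ≠ x0} := S.subtype _

lemma mem_restr {x0 : ι} {S : Finset ι} {i : {i : ι // i ≠ x0}} :
    i ∈ restr x0 S ↔ i.1 ∈ S := by simp [restr]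

/-- Embedding of a set of remaining covariates. -/
def emb {x0 : ι} (B : Finset {i : ι // i ≠ x0}) : Finset ι :=
  B.map (Function.Embedding.subtype _)

lemma mem_emb {x0 : ι} {B : Finset {i : ι // i ≠ x0}} (i : {i : ι // i ≠ x0}) :
    i.1 ∈ emb B ↔ i ∈ B := by
  simp [emb, i.2]

lemma x0_not_mem_emb {x0 : ι} {B : Finset {i : ι // i ≠ x0}} : x0 ∉ emb B := by
  simp [emb]

lemma restr_emb {x0 : ι} (B : Finset {i : ι // i ≠ x0}) : restr x0 (emb B) = B := by
  ext i; rw [mem_restr, mem_emb]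

lemma restr_insert_emb {x0 : ι} (B : Finset {i : ι // i ≠ x0}) :
    restr x0 (insert x0 (emb B)) = B := by
  ext i; rw [mem_restr, Finset.mem_insert, mem_emb]; simp [i.2]

/-- Simulation of walks of the graph in the contracted graph. -/
lemma reach_contract (E : Option ι → Option ι → Prop) (x0 : ι) (S : Finset ι)
    {v : Option ι} {d : Bool} (h : BReach E none (XSet S) v d) :
    ∀ i : {i : ι // i ≠ x0}, v = some i.1 →
      BReach (contractEdge E x0) none (XSet (restr x0 S)) (some i) d := by
  have cases3 : ∀ v : Option ι, (v = none ∨ v = some x0) ∨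
      ∃ j : {i : ι // i ≠ x0}, v = some j.1 := by
    rintro (_ | j)
    · simp
    · by_cases hj : j = x0
      · simp [hj]
      · exact Or.inr ⟨⟨j, hj⟩, rfl⟩
  have hin : ∀ j : {i : ι // i ≠ x0}, some j.1 ∈ XSet S ↔ some j ∈ XSet (restr x0 S) := by
    intro j; rw [some_mem_XSet, some_mem_XSet, mem_restr]
  induction h with
  | start => intro i hi; simp at hi
  | @fwd v w d h1 e hn ih =>
    rintro i rfl
    rcases cases3 v with hv | ⟨j, rfl⟩
    · refine BReach.fwd .start ?_ none_not_mem_XSet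
      rcases hv with rfl | rfl
      · exact Or.inl e
      · exact Or.inr e
    · exact (ih j rfl).fwd e (fun h => hn ((hin j).2 h))
  | @coll v w h1 e hn ih =>
    rintro i rfl
    rcases cases3 v with hv | ⟨j, rfl⟩
    · refine BReach.bwd .start ?_ none_not_mem_XSet
      rcases hv with rfl | rfl
      · exact Or.inl e
      · exact Or.inr e
    · exact (ih j rfl).coll e ((hin j).1 hn)
  | @bwd v w h1 e hn ih =>
    rintro i rfl
    rcases cases3 v with hv | ⟨j, rfl⟩
    · refine BReach.bwd .start ?_ none_not_mem_XSet
      rcases hv with rfl | rfl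
      · exact Or.inl e
      · exact Or.inr e
    · exact (ih j rfl).bwd e (fun h => hn ((hin j).2 h))

/-- Lifting of walks of the contracted graph, up to an exceptional set of vertices `D`
which is closed under edges among remaining covariates and avoids the conditioning set. -/
lemma reach_lift (E : Option ι → Option ι → Prop) (x0 : ι) (S : Finset ι)
    (D : {i : ι // i ≠ x0} → Prop)
    (hD : ∀ i, D i → i.1 ∉ S) (hD' : ∀ i j, D i → E (some i.1) (some j.1) → D j)
    (hout : ∀ i : {i : ι // i ≠ x0}, E (some x0) (some i.1) →
      BReach E none (XSet S) (some i.1) true ∨ D i)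
    (hinn : ∀ i : {i : ι // i ≠ x0}, E (some i.1) (some x0) →
      BReach E none (XSet S) (some i.1) false)
    {v : Option {i : ι // i ≠ x0}} {d : Bool}
    (h : BReach (contractEdge E x0) none (XSet (restr x0 S)) v d) :
    ∀ i : {i : ι // i ≠ x0}, v = some i →
      BReach E none (XSet S) (some i.1) d ∨ (d = true ∧ D i) := by
  have hin : ∀ j : {i : ι // i ≠ x0}, some j.1 ∈ XSet S ↔ some j ∈ XSet (restr x0 S) := by
    intro j; rw [some_mem_XSet, some_mem_XSet, mem_restr]
  induction h with
  | start => intro i hi; simp at hi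
  | @fwd v w d h1 e hn ih =>
    rintro i rfl
    rcases v with _ | j
    · rcases e with e | e
      · exact Or.inl (BReach.start.fwd e none_not_mem_XSet)
      · simpa using hout i e
    · rcases ih j rfl with h | ⟨-, h⟩
      · exact Or.inl (h.fwd e (fun h => hn ((hin j).1 h)))
      · exact Or.inr ⟨rfl, hD' j i h e⟩
  | @coll v w h1 e hn ih =>
    rintro i rfl
    rcases v with _ | j
    · exact absurd hn none_not_mem_XSet
    · rcases ih j rfl with h | ⟨-, h⟩
      · exact Or.inl (h.coll e ((hin j).2 hn))
      · exact absurd (some_mem_XSet.1 ((hin j).2 hn)) (hD j h)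
  | @bwd v w h1 e hn ih =>
    rintro i rfl
    rcases v with _ | j
    · rcases e with e | e
      · exact Or.inl (BReach.start.bwd e none_not_mem_XSet)
      · exact Or.inl (hinn i e)
    · rcases ih j rfl with h | ⟨h, -⟩
      · exact Or.inl (h.bwd e (fun h => hn ((hin j).1 h)))
      · simp at h

variable (G : DAG (Option ι)) (x0 : ι)
  (hacyc : ∀ v, ¬ Relation.TransGen (contractEdge G.edge x0) v v)

lemma stab_restr {S : Finset ι} (h : Stab G S) :
    Stab (⟨contractEdge G.edge x0, hacyc⟩ : DAG (Option {i : ι // i ≠ x0})) (restr x0 S) := by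
  intro i hi
  obtain ⟨d, hd⟩ := h i.1 (mem_restr.1 hi)
  exact ⟨d, reach_contract _ x0 S hd i rfl⟩

lemma stab_lift (hadj : SkelAdj G none (some x0)) {B : Finset {i : ι // i ≠ x0}}
    (h : Stab (⟨contractEdge G.edge x0, hacyc⟩ : DAG (Option {i : ι // i ≠ x0})) B) :
    Stab G (emb B) ∨ Stab G (insert x0 (emb B)) := by
  have mem_cases : ∀ i ∈ emb B, ∃ j : {i : ι // i ≠ x0}, j.1 = i := by
    intro i hi
    exact ⟨⟨i, fun h' => x0_not_mem_emb (h' ▸ hi)⟩, rfl⟩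
  have hx0 : some x0 ∉ XSet (emb B) := fun h => x0_not_mem_emb (some_mem_XSet.1 h)
  have good : (∀ i : {i : ι // i ≠ x0}, G.edge (some x0) (some i.1) →
        BReach G.edge none (XSet (emb B)) (some i.1) true) →
      (∀ i : {i : ι // i ≠ x0}, G.edge (some i.1) (some x0) →
        BReach G.edge none (XSet (emb B)) (some i.1) false) → Stab G (emb B) := by
    intro h1 h2 i hi
    obtain ⟨j, rfl⟩ := mem_cases i hi
    obtain ⟨d, hd⟩ := h j ((mem_emb j).1 hi)
    have hd' : BReach (contractEdge G.edge x0) none (XSet (restr x0 (emb B))) (some j) d := by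
      rw [restr_emb]; exact hd
    rcases reach_lift G.edge x0 (emb B) (fun _ => False) (by simp) (by simp)
      (fun i hi => Or.inl (h1 i hi)) h2 hd' j rfl with h3 | h3
    · exact ⟨d, h3⟩
    · exact absurd h3.2 id
  rcases hadj with hadj | hadj
  · by_cases hdesc : ∃ b ∈ XSet (emb B), Relation.ReflTransGen G.edge (some x0) b
    · left
      obtain ⟨b, hb, hb'⟩ := hdesc
      have hr : BReach G.edge none (XSet (emb B)) (some x0) true :=
        BReach.start.fwd hadj none_not_mem_XSet
      exact good (fun i hi => hr.fwd hi hx0) (fun i hi => BReach.up hb' hb hr _ hi)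
    · right
      push Not at hdesc
      have hr : BReach G.edge none (XSet (insert x0 (emb B))) (some x0) true :=
        BReach.start.fwd hadj none_not_mem_XSet
      intro i hi
      rcases Finset.mem_insert.1 hi with rfl | hi
      · exact ⟨_, hr⟩
      obtain ⟨j, rfl⟩ := mem_cases i hi
      obtain ⟨d, hd⟩ := h j ((mem_emb j).1 hi)
      have hd' : BReach (contractEdge G.edge x0) none
          (XSet (restr x0 (insert x0 (emb B)))) (some j) d := by
        rw [restr_insert_emb]; exact hd
      have hDS : ∀ i : {i : ι // i ≠ x0}, Relation.ReflTransGen G.edge (some x0) (some i.1) →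
          i.1 ∉ insert x0 (emb B) := by
        intro i hi h'
        rcases Finset.mem_insert.1 h' with h' | h'
        · exact i.2 h'
        · exact hdesc _ (some_mem_XSet.2 h') hi
      rcases reach_lift G.edge x0 (insert x0 (emb B))
        (fun i => Relation.ReflTransGen G.edge (some x0) (some i.1))
        hDS (fun i j hi hij => hi.tail hij)
        (fun i hi => Or.inr (.single hi))
        (fun i hi => hr.coll hi (some_mem_XSet.2 (Finset.mem_insert_self _ _))) hd' j rfl
        with h3 | h3
      · exact ⟨d, h3⟩
      · exact absurd h3.2 (hdesc _ (some_mem_XSet.2 hi))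
  · left
    have hr : BReach G.edge none (XSet (emb B)) (some x0) false :=
      BReach.start.bwd hadj none_not_mem_XSet
    exact good (fun i hi => hr.fwd hi hx0) (fun i hi => hr.bwd hi hx0)

lemma stab_singleton (hadj : SkelAdj G none (some x0)) : Stab G {x0} := by
  intro i hi
  obtain rfl := Finset.mem_singleton.1 hi
  rcases hadj with h | h
  · exact ⟨_, BReach.start.fwd h none_not_mem_XSet⟩
  · exact ⟨_, BReach.start.bwd h none_not_mem_XSet⟩

end merge

/-- Let `G` be a DAG over a target `Y` and covariates such that `Y`
is adjacent to a covariate `X₀` and every other covariate is adjacent to at most one of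
`Y` and `X₀`. Let `G̃` be obtained by contracting `Y` and `X₀` into a new target `Ỹ`
(assumed acyclic). Then `N_{G̃} + 1 ≤ N_G ≤ 2·N_{G̃}`. -/
theorem NG_merge_single {ι : Type*} [DecidableEq ι] [Fintype ι]
    (G : DAG (Option ι)) (x0 : ι)
    (hadj : SkelAdj G none (some x0))
    (hone : ∀ v : ι, v ≠ x0 →
      ¬ (SkelAdj G (some v) none ∧ SkelAdj G (some v) (some x0)))
    (hacyc : ∀ v, ¬ Relation.TransGen (contractEdge G.edge x0) v v) :
    NG (⟨contractEdge G.edge x0, hacyc⟩ : DAG (Option {i : ι // i ≠ x0})) + 1 ≤ NG G ∧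
    NG G ≤ 2 * NG (⟨contractEdge G.edge x0, hacyc⟩ : DAG (Option {i : ι // i ≠ x0})) := by
  rw [NG_eq, NG_eq]
  have hempty : Stab G ∅ := by intro i hi; simp at hi
  constructor
  · classical
    rw [← Finite.card_option]
    let g : {B // Stab (⟨contractEdge G.edge x0, hacyc⟩ : DAG (Option {i : ι // i ≠ x0})) B} →
        {B // Stab G B} := fun B =>
      if h : Stab G (emb B.1) then ⟨_, h⟩
      else ⟨insert x0 (emb B.1), (stab_lift G x0 hacyc hadj B.2).resolve_left h⟩
    have hg : ∀ B, restr x0 (g B).1 = B.1 := by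
      intro B
      by_cases h : Stab G (emb B.1)
      · simp only [g, dif_pos h]; exact restr_emb _
      · simp only [g, dif_neg h]; exact restr_insert_emb _
    have hne : ∀ B, (g B).1 ≠ {x0} := by
      intro B hB
      have h1 : B.1 = ∅ := by
        rw [← hg B, hB]
        ext i
        rw [mem_restr]
        simp [i.2]
      have h2 : emb B.1 = ∅ := by rw [h1]; rfl
      have h3 : (g B).1 = emb B.1 := by
        have h : Stab G (emb B.1) := by rw [h2]; exact hempty
        simp only [g, dif_pos h]
      rw [h3, h2] at hB
      exact absurd hB.symm (Finset.singleton_ne_empty x0)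
    refine Nat.card_le_card_of_injective
      (fun o : Option _ => o.elim ⟨{x0}, stab_singleton G x0 hadj⟩ g) ?_
    rintro (_ | B) (_ | C) hBC
    · rfl
    · exact absurd (congrArg Subtype.val hBC).symm (hne C)
    · exact absurd (congrArg Subtype.val hBC) (hne B)
    · have h1 : g B = g C := hBC
      rw [Option.some_inj]
      exact Subtype.ext (by rw [← hg B, ← hg C, h1])
  · have h2 : 2 = Nat.card Bool := by simp
    rw [h2, ← Nat.card_prod]
    refine Nat.card_le_card_of_injective
      (fun B => (decide (x0 ∈ B.1), ⟨restr x0 B.1, stab_restr G x0 hacyc B.2⟩)) ?_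
    rintro ⟨B, hB⟩ ⟨C, hC⟩ hBC
    simp only [Prod.mk.injEq, decide_eq_decide, Subtype.mk.injEq] at hBC
    refine Subtype.ext ?_
    ext i
    by_cases hi : i = x0
    · rw [hi]; exact hBC.1
    · have := congrArg (fun S => (⟨i, hi⟩ : {i : ι // i ≠ x0}) ∈ S) hBC.2
      simpa only [mem_restr, eq_iff_iff] using this
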